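/- arXiv:1611.02675 — 4 statements merged into one kernel-verified Lean document; each statement's English description precedes it below -/
import Mathlib

section
/- Proposition 5.2. Fix an integer k ≥ 1 and consider a scaling with Λ_1(n) = α_n λ_1(n) = (log n + (k−1) log log n + γ_n)/n. If P_n = Ω(n), K_{r,n}/K_{1,n} = o(log n), and γ_n → +∞ as n → ∞, then K_{1,n} → ∞ as n → ∞ (i.e., K_{1,n} = ω(1)). -/
open Finset Filter Real
open scoped Classical

/-- A configuration: class assignment, key rings, channel on/off indicators. -/
abbrev Cfg (n r P : ℕ) := (Fin n → Fin r) × (Fin n → Finset (Fin P)) × (Fin n → Fin n → Bool)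

/-- Adjacency in the intersection graph `H(n)`: distinct vertices sharing a key
with the channel between them on. -/
def adj {n r P : ℕ} (ω : Cfg n r P) (x y : Fin n) : Prop :=
  x ≠ y ∧ ((ω.2.1 x) ∩ (ω.2.1 y)).Nonempty ∧ ω.2.2 (min x y) (max x y) = true

/-- Degree of a vertex in `H(n)`. -/
noncomputable def deg {n r P : ℕ} (ω : Cfg n r P) (x : Fin n) : ℕ :=
  (Finset.univ.filter (fun y => adj ω x y)).card

/-- Probability weight of a configuration: classes are i.i.d. with law `μ`,
key rings uniform over `K`-subsets given the class, channels i.i.d. Bernoulli(`α`). -/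
noncomputable def wt {n r P : ℕ} (μ : Fin r → ℝ) (K : Fin r → ℕ) (α : ℝ)
    (ω : Cfg n r P) : ℝ :=
  (∏ x : Fin n, μ (ω.1 x) *
      (if (ω.2.1 x).card = K (ω.1 x) then ((P.choose (K (ω.1 x)) : ℝ))⁻¹ else 0)) *
  ∏ p ∈ Finset.univ.filter (fun p : Fin n × Fin n => p.1 < p.2),
      (if ω.2.2 p.1 p.2 then α else 1 - α)

/-- Probability of an event under the random graph model. -/
noncomputable def Pr {n r P : ℕ} (μ : Fin r → ℝ) (K : Fin r → ℕ) (α : ℝ)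
    (E : Cfg n r P → Prop) : ℝ :=
  ∑ ω : Cfg n r P, if E ω then wt μ K α ω else 0

/-- Key-graph edge probability `p_{ij}` between a class-`i` and a class-`j` node. -/
noncomputable def pEdge {r : ℕ} (Pn : ℕ) (Kn : Fin r → ℕ) (i j : Fin r) : ℝ :=
  1 - ((Pn - Kn i).choose (Kn j) : ℝ) / ((Pn.choose (Kn j) : ℝ))

/-- Mean key-graph edge probability `λ_i` for a class-`i` node. -/
noncomputable def lam {r : ℕ} (μ : Fin r → ℝ) (Pn : ℕ) (Kn : Fin r → ℕ) (i : Fin r) : ℝ :=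
  ∑ j, μ j * pEdge Pn Kn i j

/-- The probability that a fixed `a`-subset meets a uniform `b`-subset of a `P`-set is at most
`a * b / P`, with denominators cleared. -/
theorem mul_choose_le_mul_choose_sub_add (P b : ℕ) :
    ∀ a : ℕ, a ≤ P → P * P.choose b ≤ P * (P - a).choose b + a * b * P.choose b := by
  intro a
  induction a with
  | zero => intro _; simp
  | succ a ih =>
    intro ha
    specialize ih (by omega)
    obtain ⟨m, hm⟩ : ∃ m, P - a = m + 1 := ⟨P - a - 1, by omega⟩
    obtain ⟨p, rfl⟩ : ∃ p, P = p + 1 := ⟨P - 1, by omega⟩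
    have hm' : p + 1 - (a + 1) = m := by omega
    rw [hm] at ih
    rw [hm']
    cases b with
    | zero => simp
    | succ d =>
      have h1 := Nat.choose_succ_succ m d
      have h2 : m.choose d ≤ p.choose d := Nat.choose_le_choose d (by omega)
      have h3 := Nat.add_one_mul_choose_eq p d
      simp only [Nat.succ_eq_add_one] at h1 h3
      rw [h1] at ih
      have h4 := Nat.mul_le_mul_left (p + 1) h2
      nlinarith

theorem pEdge_le_mul_div {r : ℕ} {P : ℕ} {K : Fin r → ℕ} {i j : Fin r}
    (hP : 0 < P) (hi : K i ≤ P) (hj : K j ≤ P) :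
    pEdge P K i j ≤ (K i : ℝ) * K j / P := by
  have hC : (0 : ℝ) < P.choose (K j) := by exact_mod_cast Nat.choose_pos hj
  have hP' : (0 : ℝ) < P := by exact_mod_cast hP
  have h : (P : ℝ) * P.choose (K j) ≤
      P * (P - K i).choose (K j) + K i * K j * P.choose (K j) := by
    exact_mod_cast mul_choose_le_mul_choose_sub_add P (K j) (K i) hi
  unfold pEdge
  rw [sub_le_iff_le_add, div_add_div _ _ hP'.ne' hC.ne', le_div_iff₀ (mul_pos hP' hC)]
  linarith

/-- If every ring size is at most `M`, the mean edge probability is at most `K i * M / P`. -/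
theorem lam_le_mul_div {r : ℕ} {μ : Fin r → ℝ} {P M : ℕ} {K : Fin r → ℕ} (i : Fin r)
    (hμ : ∀ j, 0 ≤ μ j) (hsum : ∑ j, μ j = 1) (hP : 0 < P) (hM : M ≤ P)
    (hK : ∀ j, K j ≤ M) :
    lam μ P K i ≤ (K i : ℝ) * M / P := by
  calc lam μ P K i ≤ ∑ j, μ j * ((K i : ℝ) * M / P) := by
        refine Finset.sum_le_sum fun j _ => mul_le_mul_of_nonneg_left ?_ (hμ j)
        refine (pEdge_le_mul_div hP ((hK i).trans hM) ((hK j).trans hM)).trans ?_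
        have : (K j : ℝ) ≤ M := by exact_mod_cast hK j
        gcongr
    _ = (K i : ℝ) * M / P := by rw [← Finset.sum_mul, hsum, one_mul]

/-- Proposition 5.2: under the stated conditions, `K_{1,n} → ∞`. -/
theorem K1_tendsto_atTop
    (r : ℕ) (hr : 0 < r) (μ : Fin r → ℝ)
    (hμpos : ∀ i, 0 < μ i) (hμsum : ∑ i, μ i = 1)
    (Kf : ℕ → Fin r → ℕ) (Pf : ℕ → ℕ) (αf : ℕ → ℝ)
    (hKmono : ∀ n, 2 ≤ n → ∀ i j : Fin r, i ≤ j → Kf n i ≤ Kf n j)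
    (hK2 : ∀ n, 2 ≤ n → 2 ≤ Kf n ⟨0, hr⟩)
    (hKP : ∀ n, 2 ≤ n → 2 * Kf n ⟨r - 1, Nat.sub_lt hr Nat.one_pos⟩ ≤ Pf n)
    (hα : ∀ n, 2 ≤ n → 0 < αf n ∧ αf n < 1)
    (k : ℕ) (hk : 1 ≤ k) (γ : ℕ → ℝ)
    (hγdef : ∀ n, 2 ≤ n → αf n * lam μ (Pf n) (Kf n) (⟨0, hr⟩ : Fin r) =
      (Real.log n + ((k : ℝ) - 1) * Real.log (Real.log n) + γ n) / n)
    (hPΩ : ∃ c : ℝ, 0 < c ∧ ∀ᶠ n : ℕ in atTop, c * (n : ℝ) ≤ (Pf n : ℝ))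
    (hKrK1 : Tendsto (fun n : ℕ =>
      ((Kf n (⟨r - 1, Nat.sub_lt hr Nat.one_pos⟩ : Fin r) : ℝ) / (Kf n (⟨0, hr⟩ : Fin r) : ℝ)) / Real.log n) atTop (nhds 0))
    (hγ : Tendsto γ atTop atTop) :
    Tendsto (fun n : ℕ => Kf n (⟨0, hr⟩ : Fin r)) atTop atTop := by
  obtain ⟨c, hc, hPc⟩ := hPΩ
  rw [tendsto_atTop]
  intro N
  have hε : 0 < c / ((N : ℝ) ^ 2 + 1) := by positivity
  filter_upwards [hPc, hKrK1.eventually (gt_mem_nhds hε), hγ.eventually_ge_atTop 0,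
    eventually_ge_atTop 3] with n hPn hratio hγn hn
  by_contra! hlt
  set K₁ := Kf n ⟨0, hr⟩
  set Kᵣ := Kf n ⟨r - 1, Nat.sub_lt hr Nat.one_pos⟩
  have hn2 : 2 ≤ n := by omega
  have hn0 : (0 : ℝ) < n := by positivity
  have hK₁ : 2 ≤ K₁ := hK2 n hn2
  have hmono : ∀ j, Kf n j ≤ Kᵣ := fun j =>
    hKmono n hn2 _ _ (Fin.mk_le_mk.2 (by omega : j.1 ≤ r - 1))
  have hKᵣP : 2 * Kᵣ ≤ Pf n := hKP n hn2
  have hK₁Kᵣ : K₁ ≤ Kᵣ := hmono _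
  have hlog : 1 ≤ Real.log n := by
    rw [Real.le_log_iff_exp_le hn0]
    have : (3 : ℝ) ≤ n := by exact_mod_cast hn
    linarith [Real.exp_one_lt_d9]
  have hloglog : 0 ≤ ((k : ℝ) - 1) * Real.log (Real.log n) :=
    mul_nonneg (sub_nonneg.2 (by exact_mod_cast hk)) (Real.log_nonneg hlog)
  have hlam : lam μ (Pf n) (Kf n) ⟨0, hr⟩ ≤ (K₁ : ℝ) * Kᵣ / Pf n :=
    lam_le_mul_div _ (fun j => (hμpos j).le) hμsum (by omega) (by omega) hmono
  have hbound : αf n * lam μ (Pf n) (Kf n) ⟨0, hr⟩ ≤ (K₁ : ℝ) * Kᵣ / (c * n) := by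
    have hα' := hα n hn2
    calc αf n * lam μ (Pf n) (Kf n) ⟨0, hr⟩ ≤ αf n * ((K₁ : ℝ) * Kᵣ / Pf n) :=
          mul_le_mul_of_nonneg_left hlam hα'.1.le
      _ ≤ (K₁ : ℝ) * Kᵣ / Pf n := mul_le_of_le_one_left (by positivity) hα'.2.le
      _ ≤ (K₁ : ℝ) * Kᵣ / (c * n) := by gcongr
  rw [hγdef n hn2, div_le_div_iff₀ hn0 (by positivity)] at hbound
  have hlower : c * Real.log n ≤ (K₁ : ℝ) * Kᵣ := by
    refine le_of_mul_le_mul_right ?_ hn0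
    refine le_trans ?_ hbound
    have : 0 ≤ (((k : ℝ) - 1) * Real.log (Real.log n) + γ n) * (c * n) := by positivity
    linarith
  have hK₁pos : (0 : ℝ) < K₁ := by exact_mod_cast (by omega : 0 < K₁)
  have hN : (K₁ : ℝ) ≤ N := by exact_mod_cast hlt.le
  rw [div_lt_iff₀ (by linarith), div_lt_iff₀ hK₁pos] at hratio
  have hsq : (K₁ : ℝ) * K₁ < (N : ℝ) ^ 2 + 1 := by nlinarith
  have hupper : (K₁ : ℝ) * Kᵣ < c * Real.log n :=
    calc (K₁ : ℝ) * Kᵣ < K₁ * (c / ((N : ℝ) ^ 2 + 1) * Real.log n * K₁) := by gcongr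
      _ = c * Real.log n * ((K₁ : ℝ) * K₁ / ((N : ℝ) ^ 2 + 1)) := by ring
      _ ≤ c * Real.log n := mul_le_of_le_one_right (by positivity)
          ((div_le_one (by positivity)).2 hsq.le)
  linarith
end

section
/- Lemma 9.1, part 1. Let ℓ be a fixed nonnegative integer, and suppose the sequence β_{ℓ,n} defined by Λ_1(n) = (log n + ℓ log log n + β_{ℓ,n})/n satisfies β_{ℓ,n} = o(log n). Then for all n sufficiently large, (1/2)·(log n)/n ≤ α_n p_{1r}(n) ≤ (2/μ_r)·(log n)/n; in particular α_n p_{1r}(n) = Θ((log n)/n). -/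
open Finset Filter Real
open scoped Classical

/-- The ratio `C(a, k) / C(P, k)` is nonincreasing in `k ≤ P` when `a ≤ P`. -/
theorem choose_div_choose_le_of_le {a P j k : ℕ} (ha : a ≤ P) (hjk : j ≤ k) (hk : k ≤ P) :
    (a.choose k : ℝ) / (P.choose k : ℝ) ≤ (a.choose j : ℝ) / (P.choose j : ℝ) := by
  induction k, hjk using Nat.le_induction with
  | base => exact le_rfl
  | succ k _ ih =>
    refine le_trans ?_ (ih (by omega))
    have h1 : 0 < P.choose k := Nat.choose_pos (by omega)
    have h2 : 0 < P.choose (k + 1) := Nat.choose_pos hk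
    rw [div_le_div_iff₀ (by exact_mod_cast h2) (by exact_mod_cast h1)]
    norm_cast
    refine Nat.le_of_mul_le_mul_right (c := k + 1) ?_ (Nat.succ_pos k)
    calc a.choose (k + 1) * P.choose k * (k + 1)
        = a.choose (k + 1) * (k + 1) * P.choose k := by ring
      _ = a.choose k * P.choose k * (a - k) := by rw [Nat.choose_succ_right_eq]; ring
      _ ≤ a.choose k * P.choose k * (P - k) := by gcongr
      _ = a.choose k * (P.choose k * (P - k)) := by ring
      _ = a.choose k * P.choose (k + 1) * (k + 1) := by rw [← Nat.choose_succ_right_eq]; ring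

theorem pEdge_le_pEdge {r : ℕ} {P : ℕ} {K : Fin r → ℕ} (i : Fin r) {j k : Fin r}
    (hjk : K j ≤ K k) (hk : K k ≤ P) : pEdge P K i j ≤ pEdge P K i k :=
  sub_le_sub_left (choose_div_choose_le_of_le (Nat.sub_le _ _) hjk hk) 1

theorem pEdge_nonneg {r : ℕ} {P : ℕ} {K : Fin r → ℕ} (i : Fin r) {j : Fin r}
    (hj : K j ≤ P) : 0 ≤ pEdge P K i j := by
  have h := choose_div_choose_le_of_le (Nat.sub_le P (K i)) (Nat.zero_le (K j)) hj
  simp only [Nat.choose_zero_right, Nat.cast_one, div_one] at h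
  exact sub_nonneg.2 h

/-- Lemma 9.1, part 1: `(1/2)(log n)/n ≤ αₙ p₁ᵣ(n) ≤ (2/μᵣ)(log n)/n` for all
`n` sufficiently large. -/
theorem alpha_p1r_theta_log_over_n
    (r : ℕ) (hr : 0 < r) (μ : Fin r → ℝ)
    (hμpos : ∀ i, 0 < μ i) (hμsum : ∑ i, μ i = 1)
    (Kf : ℕ → Fin r → ℕ) (Pf : ℕ → ℕ) (αf : ℕ → ℝ)
    (hKmono : ∀ n, 2 ≤ n → ∀ i j : Fin r, i ≤ j → Kf n i ≤ Kf n j)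
    (hK2 : ∀ n, 2 ≤ n → 2 ≤ Kf n ⟨0, hr⟩)
    (hKP : ∀ n, 2 ≤ n → 2 * Kf n ⟨r - 1, Nat.sub_lt hr Nat.one_pos⟩ ≤ Pf n)
    (hα : ∀ n, 2 ≤ n → 0 < αf n ∧ αf n < 1)
    (ℓ : ℕ) (β : ℕ → ℝ)
    (hβdef : ∀ n, 2 ≤ n → αf n * lam μ (Pf n) (Kf n) (⟨0, hr⟩ : Fin r) =
      (Real.log n + (ℓ : ℝ) * Real.log (Real.log n) + β n) / n)
    (hβo : Tendsto (fun n : ℕ => β n / Real.log n) atTop (nhds 0)) :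
    ∀ᶠ n : ℕ in atTop,
      (1/2) * Real.log n / n ≤ αf n * pEdge (Pf n) (Kf n) (⟨0, hr⟩ : Fin r) (⟨r - 1, Nat.sub_lt hr Nat.one_pos⟩ : Fin r) ∧
      αf n * pEdge (Pf n) (Kf n) (⟨0, hr⟩ : Fin r) (⟨r - 1, Nat.sub_lt hr Nat.one_pos⟩ : Fin r) ≤ (2 / μ (⟨r - 1, Nat.sub_lt hr Nat.one_pos⟩ : Fin r)) * Real.log n / n := by
  have hlog : Tendsto (fun n : ℕ => Real.log n) atTop atTop :=
    Real.tendsto_log_atTop.comp tendsto_natCast_atTop_atTop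
  have hloglog : Tendsto (fun n : ℕ => Real.log (Real.log n) / Real.log n) atTop (nhds 0) :=
    Real.isLittleO_log_id_atTop.tendsto_div_nhds_zero.comp hlog
  have hsmall : Tendsto (fun n : ℕ => (ℓ : ℝ) * (Real.log (Real.log n) / Real.log n) +
      β n / Real.log n) atTop (nhds 0) := by
    simpa using (hloglog.const_mul (ℓ : ℝ)).add hβo
  filter_upwards [eventually_ge_atTop 2, hlog.eventually_gt_atTop 0,
    hsmall.eventually_const_lt (show (-(1 / 2) : ℝ) < 0 by norm_num),
    hsmall.eventually_lt_const (show (0 : ℝ) < 1 by norm_num)] with n hn hL hlow hupp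
  set s : Fin r := ⟨r - 1, Nat.sub_lt hr Nat.one_pos⟩
  set z : Fin r := ⟨0, hr⟩
  rw [← mul_div_assoc, ← add_div] at hlow hupp
  rw [lt_div_iff₀ hL] at hlow
  rw [div_lt_iff₀ hL] at hupp
  have hKs : ∀ j, Kf n j ≤ Kf n s := fun j =>
    hKmono n hn j s (Fin.le_def.2 (Nat.le_sub_one_of_lt j.isLt))
  have hsP : Kf n s ≤ Pf n := by have := hKP n hn; omega
  have hlam_le : lam μ (Pf n) (Kf n) z ≤ pEdge (Pf n) (Kf n) z s :=
    calc lam μ (Pf n) (Kf n) z ≤ ∑ j, μ j * pEdge (Pf n) (Kf n) z s :=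
          Finset.sum_le_sum fun j _ =>
            mul_le_mul_of_nonneg_left (pEdge_le_pEdge z (hKs j) hsP) (hμpos j).le
      _ = pEdge (Pf n) (Kf n) z s := by rw [← Finset.sum_mul, hμsum, one_mul]
  have hle_lam : μ s * pEdge (Pf n) (Kf n) z s ≤ lam μ (Pf n) (Kf n) z :=
    Finset.single_le_sum (f := fun j => μ j * pEdge (Pf n) (Kf n) z j)
      (fun j _ => mul_nonneg (hμpos j).le (pEdge_nonneg z ((hKs j).trans hsP)))
      (Finset.mem_univ s)
  have hαn := (hα n hn).1.le
  have hβn := hβdef n hn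
  constructor
  · calc (1 / 2) * Real.log n / n
        ≤ (Real.log n + (ℓ : ℝ) * Real.log (Real.log n) + β n) / n := by
          gcongr; linarith
      _ = αf n * lam μ (Pf n) (Kf n) z := hβn.symm
      _ ≤ αf n * pEdge (Pf n) (Kf n) z s := mul_le_mul_of_nonneg_left hlam_le hαn
  · have hscaled : μ s * (αf n * pEdge (Pf n) (Kf n) z s) ≤ 2 * Real.log n / n :=
      calc μ s * (αf n * pEdge (Pf n) (Kf n) z s)
          = αf n * (μ s * pEdge (Pf n) (Kf n) z s) := by ring
        _ ≤ αf n * lam μ (Pf n) (Kf n) z := mul_le_mul_of_nonneg_left hle_lam hαn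
        _ = (Real.log n + (ℓ : ℝ) * Real.log (Real.log n) + β n) / n := hβn
        _ ≤ 2 * Real.log n / n := by gcongr; linarith
    calc αf n * pEdge (Pf n) (Kf n) z s ≤ 2 * Real.log n / n / μ s := by
          rwa [le_div_iff₀' (hμpos s)]
      _ = 2 / μ s * Real.log n / n := by ring
end

section
/- Lemma F.1 (expectation bound, Lemma 'kconn_2'). Fix ε ∈ (0,1) and suppose the scaling satisfies Λ_1(n) = o(1). For each n and each integer m ≥ 2, let N ~ Binomial(m, α_n) and let S be independent of N with P[S = K_{j,n}] = μ_j for j = 1,…,r, and define Q(N) = 0 if N = 0, Q(N) = K_{1,n} if N = 1, and Q(N) = ⌊(1+ε)K_{1,n}⌋ + 1 if N ≥ 2. Then for all n sufficiently large and every integer m ≥ 2, E[ C(P_n − Q(N), S) / C(P_n, S) ] ≤ exp(−(1 + ε/2)·Λ_1(n)). -/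
open Finset Filter Real
open scoped Classical

/-- The binomial ratio `C(P - x, k) / C(P, k)` as a product over `i < k`. -/
theorem choose_sub_div_choose_eq_prod (P x k : ℕ) :
    ((P - x).choose k : ℝ) / (P.choose k : ℝ) =
      ∏ i ∈ Finset.range k, ((P - x - i : ℕ) : ℝ) / ((P - i : ℕ) : ℝ) := by
  have hk : (k.factorial : ℝ) ≠ 0 := by exact_mod_cast k.factorial_ne_zero
  rw [Finset.prod_div_distrib, ← Nat.cast_prod, ← Nat.cast_prod,
    ← Nat.descFactorial_eq_prod_range, ← Nat.descFactorial_eq_prod_range,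
    Nat.descFactorial_eq_factorial_mul_choose, Nat.descFactorial_eq_factorial_mul_choose,
    Nat.cast_mul, Nat.cast_mul, mul_div_mul_left _ _ hk]

theorem choose_sub_div_choose_le_one (P x k : ℕ) :
    ((P - x).choose k : ℝ) / (P.choose k : ℝ) ≤ 1 :=
  div_le_one_of_le₀ (by exact_mod_cast Nat.choose_le_choose k (Nat.sub_le P x)) (by positivity)

theorem choose_sub_div_choose_anti (P k : ℕ) {x y : ℕ} (h : x ≤ y) :
    ((P - y).choose k : ℝ) / (P.choose k : ℝ) ≤ ((P - x).choose k : ℝ) / (P.choose k : ℝ) := by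
  gcongr

/-- Enlarging the excluded set by a factor `c ≥ 1` raises the binomial ratio to at least
the power `c`. -/
theorem choose_sub_div_choose_le_rpow {P K Q k : ℕ} {c : ℝ} (hc : 1 ≤ c)
    (hKP : K + k ≤ P) (hQ : c * K ≤ Q) :
    ((P - Q).choose k : ℝ) / (P.choose k : ℝ) ≤
      (((P - K).choose k : ℝ) / (P.choose k : ℝ)) ^ c := by
  rw [choose_sub_div_choose_eq_prod, choose_sub_div_choose_eq_prod,
    ← Real.finsetProd_rpow _ _ (fun i _ => by positivity)]
  refine Finset.prod_le_prod (fun i _ => by positivity) fun i hi => ?_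
  have hik : i < k := Finset.mem_range.mp hi
  rcases Nat.eq_zero_or_pos (P - Q - i) with h0 | hpos
  · rw [h0, Nat.cast_zero, zero_div]
    positivity
  have hd : (0 : ℝ) < ((P - i : ℕ) : ℝ) := by
    exact_mod_cast (show 0 < P - i by omega)
  have hdiv : ∀ z : ℕ, z + i ≤ P →
      ((P - z - i : ℕ) : ℝ) / ((P - i : ℕ) : ℝ) = 1 + -((z : ℝ) / ((P - i : ℕ) : ℝ)) := by
    intro z hz
    have hz' : ((P - z - i : ℕ) : ℝ) = ((P - i : ℕ) : ℝ) - z := by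
      rw [show P - z - i = P - i - z by omega, Nat.cast_sub (by omega)]
    rw [hz']
    field_simp
    ring
  rw [hdiv Q (by omega), hdiv K (by omega)]
  have hle : (K : ℝ) / ((P - i : ℕ) : ℝ) ≤ 1 :=
    div_le_one_of_le₀ (by exact_mod_cast (show K ≤ P - i by omega)) hd.le
  refine le_trans ?_ (one_add_mul_self_le_rpow_one_add (by linarith) hc)
  have : c * ((K : ℝ) / ((P - i : ℕ) : ℝ)) ≤ (Q : ℝ) / ((P - i : ℕ) : ℝ) := by
    rw [← mul_div_assoc]
    gcongr
  linarith

theorem rpow_one_add_le_mul {a ε : ℝ} (ha0 : 0 ≤ a) (hε0 : 0 < ε) (hε1 : ε ≤ 1) :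
    a ^ (1 + ε) ≤ a * (1 - ε * (1 - a)) := by
  rw [Real.rpow_add_of_nonneg ha0 zero_le_one hε0.le, Real.rpow_one]
  have h := rpow_one_add_le_one_add_mul_self (s := a - 1) (by linarith) hε0.le hε1
  rw [show 1 + (a - 1) = a by ring] at h
  exact mul_le_mul_of_nonneg_left (by linarith) ha0

/-- The probability that a binomial variable is at most one is at most its value
for two trials. -/
theorem binomial_le_one_prob_le {α : ℝ} (h1 : α ≤ 1) {m : ℕ} (hm : 2 ≤ m) :
    (1 - α) ^ m + (m : ℝ) * α * (1 - α) ^ (m - 1) ≤ 1 - α ^ 2 := by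
  induction m, hm using Nat.le_induction with
  | base => norm_num; nlinarith
  | succ k hk ih =>
    obtain ⟨l, rfl⟩ : ∃ l, k = l + 1 := ⟨k - 1, by omega⟩
    refine le_trans ?_ ih
    simp only [Nat.add_sub_cancel]
    push_cast
    have hp : 0 ≤ (1 - α) ^ l := pow_nonneg (by linarith) l
    have : 0 ≤ ((l : ℝ) + 1) * α ^ 2 * (1 - α) ^ l := by positivity
    rw [pow_succ, pow_succ]
    linarith

/-- The expectation of a function of a binomial variable taking values `1 ≥ a ≥ b` at
`0`, `1` and beyond is largest for two trials. -/
theorem binomial_expectation_le {α a b : ℝ} (h0 : 0 ≤ α) (h1 : α ≤ 1) (ha : a ≤ 1)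
    (hba : b ≤ a) {m : ℕ} (hm : 2 ≤ m) :
    (1 - α) ^ m + (m : ℝ) * α * (1 - α) ^ (m - 1) * a +
        (1 - (1 - α) ^ m - (m : ℝ) * α * (1 - α) ^ (m - 1)) * b ≤
      1 - 2 * α * (1 - α) * (1 - a) - α ^ 2 * (1 - b) := by
  have hF0 : (1 - α) ^ m ≤ (1 - α) ^ 2 :=
    pow_le_pow_of_le_one (by linarith) (by linarith) hm
  have hF1 := binomial_le_one_prob_le h1 hm
  nlinarith [mul_le_mul_of_nonneg_right hF0 (sub_nonneg.mpr ha),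
    mul_le_mul_of_nonneg_right hF1 (sub_nonneg.mpr hba)]

theorem one_sub_two_trials_le {α a b ε : ℝ} (h0 : 0 ≤ α) (h1 : α ≤ 1) (ha : a ≤ 1)
    (hε0 : 0 < ε) (hε1 : ε ≤ 1) (hb : b ≤ a * (1 - ε * (1 - a)))
    (hp : α * (1 - a) ≤ 1 / 2) :
    1 - 2 * α * (1 - α) * (1 - a) - α ^ 2 * (1 - b) ≤
      1 - (1 + ε / 2) * (α * (1 - a)) := by
  have hb' := mul_le_mul_of_nonneg_left hb (sq_nonneg α)
  have hq : 0 ≤ α * (1 - a) := mul_nonneg h0 (sub_nonneg.mpr ha)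
  have hcoef : 0 ≤ (1 - α) * (1 - ε) + ε * (1 / 2 - α * (1 - a)) :=
    add_nonneg (mul_nonneg (by linarith) (by linarith)) (mul_nonneg hε0.le (by linarith))
  linarith [mul_nonneg hq hcoef]

/-- Lemma F.1: expectation bound `E[C(Pₙ - Q(νₘ), |Σ|)/C(Pₙ, |Σ|)] ≤ e^{-(1+ε/2)Λ₁(n)}`,
the expectation written out as an explicit finite sum. -/
theorem expectation_bound_kconn
    (r : ℕ) (hr : 0 < r) (μ : Fin r → ℝ)
    (hμpos : ∀ i, 0 < μ i) (hμsum : ∑ i, μ i = 1)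
    (Kf : ℕ → Fin r → ℕ) (Pf : ℕ → ℕ) (αf : ℕ → ℝ)
    (hKmono : ∀ n, 2 ≤ n → ∀ i j : Fin r, i ≤ j → Kf n i ≤ Kf n j)
    (hK2 : ∀ n, 2 ≤ n → 2 ≤ Kf n ⟨0, hr⟩)
    (hKP : ∀ n, 2 ≤ n → 2 * Kf n ⟨r - 1, Nat.sub_lt hr Nat.one_pos⟩ ≤ Pf n)
    (hα : ∀ n, 2 ≤ n → 0 < αf n ∧ αf n < 1)
    (ε : ℝ) (hε : 0 < ε ∧ ε < 1)
    (hΛ : Tendsto (fun n : ℕ => αf n * lam μ (Pf n) (Kf n) (⟨0, hr⟩ : Fin r)) atTop (nhds 0)) :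
    ∀ᶠ n : ℕ in atTop, ∀ m : ℕ, 2 ≤ m →
      ∑ j : Fin r, μ j *
        ((1 - αf n) ^ m +
          (m : ℝ) * αf n * (1 - αf n) ^ (m - 1) *
            (((Pf n - Kf n (⟨0, hr⟩ : Fin r)).choose (Kf n j) : ℝ) / ((Pf n).choose (Kf n j) : ℝ)) +
          (1 - (1 - αf n) ^ m - (m : ℝ) * αf n * (1 - αf n) ^ (m - 1)) *
            (((Pf n - (⌊(1 + ε) * (Kf n (⟨0, hr⟩ : Fin r) : ℝ)⌋₊ + 1)).choose (Kf n j) : ℝ) /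
              ((Pf n).choose (Kf n j) : ℝ))) ≤
      Real.exp (-((1 + ε/2) * (αf n * lam μ (Pf n) (Kf n) (⟨0, hr⟩ : Fin r)))) := by
  have hsmall : ∀ᶠ n : ℕ in atTop, ∀ j : Fin r,
      αf n * lam μ (Pf n) (Kf n) ⟨0, hr⟩ ≤ μ j / 2 :=
    eventually_all.mpr fun j => hΛ.eventually_le_const (half_pos (hμpos j))
  filter_upwards [hsmall, eventually_ge_atTop 2] with n hn hn2 m hm
  obtain ⟨hα0, hα1⟩ := hα n hn2
  set i₀ : Fin r := ⟨0, hr⟩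
  set α := αf n
  set Q := ⌊(1 + ε) * (Kf n i₀ : ℝ)⌋₊ + 1
  have hQ : (1 + ε) * (Kf n i₀ : ℝ) ≤ (Q : ℕ) := by
    simpa [Q] using (Nat.lt_floor_add_one ((1 + ε) * (Kf n i₀ : ℝ))).le
  have hKQ : Kf n i₀ ≤ Q := by
    have : (0 : ℝ) ≤ ε * Kf n i₀ := mul_nonneg hε.1.le (Nat.cast_nonneg _)
    exact_mod_cast (show (Kf n i₀ : ℝ) ≤ Q by linarith)
  have hp_nonneg : ∀ j, 0 ≤ pEdge (Pf n) (Kf n) i₀ j := fun j =>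
    sub_nonneg.mpr (choose_sub_div_choose_le_one _ _ _)
  have hterm : ∀ j : Fin r,
      (1 - α) ^ m + (m : ℝ) * α * (1 - α) ^ (m - 1) *
            (((Pf n - Kf n i₀).choose (Kf n j) : ℝ) / ((Pf n).choose (Kf n j) : ℝ)) +
          (1 - (1 - α) ^ m - (m : ℝ) * α * (1 - α) ^ (m - 1)) *
            (((Pf n - Q).choose (Kf n j) : ℝ) / ((Pf n).choose (Kf n j) : ℝ)) ≤
        1 - (1 + ε / 2) * (α * pEdge (Pf n) (Kf n) i₀ j) := by
    intro j
    have hKK : Kf n i₀ + Kf n j ≤ Pf n := by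
      have h1 := hKmono n hn2 i₀ j (Nat.zero_le _)
      have h2 := hKmono n hn2 j ⟨r - 1, Nat.sub_lt hr Nat.one_pos⟩ (Nat.le_sub_one_of_lt j.2)
      have h3 := hKP n hn2
      omega
    have ha1 := choose_sub_div_choose_le_one (Pf n) (Kf n i₀) (Kf n j)
    refine (binomial_expectation_le hα0.le hα1.le ha1
      (choose_sub_div_choose_anti _ _ hKQ) hm).trans
      (one_sub_two_trials_le hα0.le hα1.le ha1 hε.1 hε.2.le
        ((choose_sub_div_choose_le_rpow (by linarith [hε.1]) hKK hQ).trans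
          (rpow_one_add_le_mul (by positivity) hε.1 hε.2.le)) ?_)
    have hle : μ j * pEdge (Pf n) (Kf n) i₀ j ≤ lam μ (Pf n) (Kf n) i₀ :=
      Finset.single_le_sum (f := fun j => μ j * pEdge (Pf n) (Kf n) i₀ j)
        (fun j _ => mul_nonneg (hμpos j).le (hp_nonneg j)) (Finset.mem_univ j)
    have hmul : μ j * (α * pEdge (Pf n) (Kf n) i₀ j) ≤ μ j * (1 / 2) := by
      linarith [mul_le_mul_of_nonneg_left hle hα0.le, hn j]
    exact le_of_mul_le_mul_left hmul (hμpos j)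
  calc _ ≤ ∑ j, μ j * (1 - (1 + ε / 2) * (α * pEdge (Pf n) (Kf n) i₀ j)) :=
        Finset.sum_le_sum fun j _ => mul_le_mul_of_nonneg_left (hterm j) (hμpos j).le
    _ = 1 - (1 + ε / 2) * (α * lam μ (Pf n) (Kf n) i₀) := by
        simp only [lam, mul_sub, mul_one, Finset.sum_sub_distrib, hμsum, Finset.mul_sum]
        congr 1
        exact Finset.sum_congr rfl fun j _ => by ring
    _ ≤ _ := Real.one_sub_le_exp_neg _
end

section
/- Lemma B.1(a), combinatorial form. Let r ≥ 1, let μ = (μ_1,…,μ_r) be a probability vector with μ_i > 0 for each i, let K_1 ≤ K_2 ≤ … ≤ K_r and P be positive integers with 2 ≤ K_1 and K_r ≤ P/2, and set p_{1i} = 1 − C(P−K_1,K_i)/C(P,K_i) and λ_1 = Σ_{i=1}^r μ_i p_{1i}. Then Σ_{i=1}^r μ_i · C(P − 2K_1, K_i)/C(P, K_i) ≤ (1 − λ_1)² + λ_1²/(4μ_r²). Consequently 2λ_1 − 1 + Σ_{i=1}^r μ_i C(P−2K_1, K_i)/C(P, K_i) ≤ (1 + 1/(4μ_r²))·λ_1²,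 which is the bound P[K_{xj} ∩ K_{yj} | not K_{xy}, t_x = t_y = 1] ≤ (1 + 1/(4μ_r²))λ_1² of the paper. -/
open Finset Filter Real
open scoped Classical

/-- For fixed lower index, binomial coefficients are log-concave in the upper index. -/
lemma choose_mul_choose_le_sq {a b c : ℕ} (hab : a ≤ b) (h : a + c = 2 * b) (l : ℕ) :
    a.choose l * c.choose l ≤ b.choose l ^ 2 := by
  induction l with
  | zero => simp
  | succ l ih =>
    have hsub : (a - l) * (c - l) ≤ (b - l) ^ 2 := by
      rcases le_total a l with hal | hal
      · simp [Nat.sub_eq_zero_of_le hal]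
      · obtain ⟨x, rfl⟩ := Nat.exists_eq_add_of_le hal
        obtain ⟨d, rfl⟩ := Nat.exists_eq_add_of_le hab
        obtain rfl : c = l + x + 2 * d := by omega
        have h₁ : l + x - l = x := by omega
        have h₂ : l + x + 2 * d - l = x + 2 * d := by omega
        have h₃ : l + x + d - l = x + d := by omega
        rw [h₁, h₂, h₃]
        nlinarith [Nat.zero_le (d ^ 2)]
    have key : (a.choose (l + 1) * c.choose (l + 1)) * (l + 1) ^ 2 ≤
        b.choose (l + 1) ^ 2 * (l + 1) ^ 2 :=
      calc (a.choose (l + 1) * c.choose (l + 1)) * (l + 1) ^ 2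
          = (a.choose (l + 1) * (l + 1)) * (c.choose (l + 1) * (l + 1)) := by ring
        _ = (a.choose l * c.choose l) * ((a - l) * (c - l)) := by
            rw [Nat.choose_succ_right_eq, Nat.choose_succ_right_eq]; ring
        _ ≤ b.choose l ^ 2 * (b - l) ^ 2 := Nat.mul_le_mul ih hsub
        _ = (b.choose (l + 1) * (l + 1)) ^ 2 := by rw [Nat.choose_succ_right_eq]; ring
        _ = b.choose (l + 1) ^ 2 * (l + 1) ^ 2 := by ring
    exact Nat.le_of_mul_le_mul_right key (by positivity)

/-- A random `l`-subset is less likely to lie inside a fixed subset as `l` grows. -/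
lemma antitone_choose_div_choose {b c : ℕ} (hbc : b ≤ c) :
    Antitone fun l : ℕ => (b.choose l : ℝ) / (c.choose l : ℝ) := by
  refine antitone_nat_of_succ_le fun l => ?_
  rcases Nat.lt_or_ge c (l + 1) with hl | hl
  · rw [Nat.choose_eq_zero_of_lt hl, Nat.cast_zero, div_zero]
    positivity
  · have h₁ : (0 : ℝ) < c.choose (l + 1) := by exact_mod_cast Nat.choose_pos hl
    have h₀ : (0 : ℝ) < c.choose l := by exact_mod_cast Nat.choose_pos (by omega)
    rw [div_le_div_iff₀ h₁ h₀]
    have key : (b.choose (l + 1) * c.choose l) * (l + 1) ≤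
        (b.choose l * c.choose (l + 1)) * (l + 1) :=
      calc (b.choose (l + 1) * c.choose l) * (l + 1)
          = (b.choose (l + 1) * (l + 1)) * c.choose l := by ring
        _ = (b.choose l * c.choose l) * (b - l) := by rw [Nat.choose_succ_right_eq]; ring
        _ ≤ (b.choose l * c.choose l) * (c - l) := by gcongr
        _ = b.choose l * (c.choose (l + 1) * (l + 1)) := by
            rw [Nat.choose_succ_right_eq]; ring
        _ = (b.choose l * c.choose (l + 1)) * (l + 1) := by ring
    exact_mod_cast Nat.le_of_mul_le_mul_right key (by positivity)

/-- Second moment bound for `1 - p`: if `0 ≤ p ≤ p m`, the variance of `p` is at most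
`(p m) ^ 2 / 4`, and `p m` is at most the mean of `p` divided by the mass at `m`. -/
lemma sum_mul_one_sub_sq_le {ι : Type*} [Fintype ι] {μ p : ι → ℝ} (m : ι)
    (hμ : ∀ i, 0 ≤ μ i) (hm : 0 < μ m) (hsum : ∑ i, μ i = 1)
    (hp : ∀ i, 0 ≤ p i) (hpm : ∀ i, p i ≤ p m) :
    ∑ i, μ i * (1 - p i) ^ 2 ≤
      (1 - ∑ i, μ i * p i) ^ 2 + (∑ i, μ i * p i) ^ 2 / (4 * μ m ^ 2) := by
  set l := ∑ i, μ i * p i with hl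
  have hexp : ∑ i, μ i * (1 - p i) ^ 2 = 1 - 2 * l + ∑ i, μ i * p i ^ 2 := by
    calc ∑ i, μ i * (1 - p i) ^ 2
        = ∑ i, (μ i - 2 * (μ i * p i) + μ i * p i ^ 2) :=
          Finset.sum_congr rfl fun i _ => by ring
      _ = 1 - 2 * l + ∑ i, μ i * p i ^ 2 := by
          rw [Finset.sum_add_distrib, Finset.sum_sub_distrib, ← Finset.mul_sum, hsum]
  have hsq : ∑ i, μ i * p i ^ 2 ≤ p m * l := by
    rw [hl, Finset.mul_sum]
    refine Finset.sum_le_sum fun i _ => ?_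
    nlinarith [mul_nonneg (mul_nonneg (hμ i) (hp i)) (sub_nonneg.2 (hpm i))]
  have hml : μ m * p m ≤ l :=
    Finset.single_le_sum (f := fun i => μ i * p i)
      (fun i _ => mul_nonneg (hμ i) (hp i)) (Finset.mem_univ m)
  have hquad : p m ^ 2 / 4 ≤ l ^ 2 / (4 * μ m ^ 2) := by
    rw [div_le_div_iff₀ (by norm_num) (by positivity)]
    nlinarith [pow_le_pow_left₀ (mul_nonneg hm.le (hp m)) hml 2]
  nlinarith [sq_nonneg (p m - 2 * l)]

/-- Lemma B.1(a), combinatorial form. -/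
theorem double_intersection_bound
    (r : ℕ) (hr : 0 < r) (μ : Fin r → ℝ)
    (hμpos : ∀ i, 0 < μ i) (hμsum : ∑ i, μ i = 1)
    (K : Fin r → ℕ) (P : ℕ)
    (hKmono : ∀ i j : Fin r, i ≤ j → K i ≤ K j)
    (hK2 : 2 ≤ K ⟨0, hr⟩)
    (hKP : 2 * K ⟨r - 1, Nat.sub_lt hr Nat.one_pos⟩ ≤ P) :
    (∑ i, μ i * (((P - 2 * K ⟨0, hr⟩).choose (K i) : ℝ) / (P.choose (K i) : ℝ)) ≤
      (1 - lam μ P K (⟨0, hr⟩ : Fin r)) ^ 2 +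
        (lam μ P K (⟨0, hr⟩ : Fin r)) ^ 2 / (4 * (μ ⟨r - 1, Nat.sub_lt hr Nat.one_pos⟩) ^ 2)) ∧
    (2 * lam μ P K (⟨0, hr⟩ : Fin r) - 1 +
        ∑ i, μ i * (((P - 2 * K ⟨0, hr⟩).choose (K i) : ℝ) / (P.choose (K i) : ℝ)) ≤
      (1 + 1 / (4 * (μ ⟨r - 1, Nat.sub_lt hr Nat.one_pos⟩) ^ 2)) *
        (lam μ P K (⟨0, hr⟩ : Fin r)) ^ 2) := by
  have hmax : ∀ i : Fin r, K i ≤ K ⟨r - 1, Nat.sub_lt hr Nat.one_pos⟩ := fun i =>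
    hKmono _ _ (Fin.mk_le_mk.2 (Nat.le_sub_one_of_lt i.isLt))
  generalize (⟨r - 1, Nat.sub_lt hr Nat.one_pos⟩ : Fin r) = m at *
  generalize (⟨0, hr⟩ : Fin r) = z at *
  have hzP : 2 * K z ≤ P := le_trans (Nat.mul_le_mul_left 2 (hmax z)) hKP
  have hanti := antitone_choose_div_choose (Nat.sub_le P (K z))
  have hsq : ∀ i, ((P - 2 * K z).choose (K i) : ℝ) / (P.choose (K i) : ℝ) ≤
      (1 - pEdge P K z i) ^ 2 := by
    intro i
    have hpos : (0 : ℝ) < P.choose (K i) := by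
      exact_mod_cast Nat.choose_pos (by have := hmax i; omega)
    have h : ((P - 2 * K z).choose (K i) : ℝ) * P.choose (K i) ≤
        ((P - K z).choose (K i) : ℝ) ^ 2 := by
      exact_mod_cast choose_mul_choose_le_sq (by omega) (by omega) (K i)
    rw [pEdge, sub_sub_cancel, div_pow, div_le_div_iff₀ hpos (by positivity)]
    nlinarith [mul_le_mul_of_nonneg_right h hpos.le]
  have hp : ∀ i, 0 ≤ pEdge P K z i := fun i =>
    sub_nonneg.2 (by simpa using hanti (Nat.zero_le (K i)))
  have hpm : ∀ i, pEdge P K z i ≤ pEdge P K z m := fun i =>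
    sub_le_sub_left (hanti (hmax i)) 1
  have hmain : ∑ i, μ i * (((P - 2 * K z).choose (K i) : ℝ) / (P.choose (K i) : ℝ)) ≤
      (1 - lam μ P K z) ^ 2 + lam μ P K z ^ 2 / (4 * μ m ^ 2) :=
    (Finset.sum_le_sum fun i _ => mul_le_mul_of_nonneg_left (hsq i) (hμpos i).le).trans
      (sum_mul_one_sub_sq_le m (fun i => (hμpos i).le) (hμpos m) hμsum hp hpm)
  refine ⟨hmain, ?_⟩
  have hring : (1 + 1 / (4 * μ m ^ 2)) * lam μ P K z ^ 2 =
      lam μ P K z ^ 2 + lam μ P K z ^ 2 / (4 * μ m ^ 2) := by ring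
  rw [hring]
  linarith
end
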